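/- For all integers k ≥ 1 and t ≥ k, B_0(k+1, 2t+1) + B_1(k, 2t) = B_1(k, 2t−2k) + p_{de}(2t−k), where B_0 and B_1 are taken to vanish when their second argument is less than their first. -/

import Mathlib

/-!
Definitions following Andrews–El Bachraoui / Chen–Chen–Zhao:
partitions with repeated smallest part.
-/

/-- The smallest part of `π` occurs exactly `k` times and all remaining parts
occur exactly once (are distinct). -/
def IsSptD (k : ℕ) {n : ℕ} (π : n.Partition) : Prop :=
  ∃ s ∈ π.parts, (∀ x ∈ π.parts, s ≤ x) ∧ Multiset.count s π.parts = k ∧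
    ∀ x ∈ π.parts, x ≠ s → Multiset.count x π.parts = 1

/-- `spt k_d(n)`: the number of partitions of `n` whose smallest part occurs
exactly `k` times and whose remaining parts are distinct. -/
noncomputable def sptd (k n : ℕ) : ℕ :=
  Nat.card {π : n.Partition // IsSptD k π}

/-- The smallest part `s` of `π` occurs exactly `k` times, and all remaining parts
occur exactly once and are incongruent to `s` modulo 2. -/
def IsSptDO (k : ℕ) {n : ℕ} (π : n.Partition) : Prop :=
  ∃ s ∈ π.parts, (∀ x ∈ π.parts, s ≤ x) ∧ Multiset.count s π.parts = k ∧
    ∀ x ∈ π.parts, x ≠ s → Multiset.count x π.parts = 1 ∧ ¬ x % 2 = s % 2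

/-- `spt k_{do}(n)`. -/
noncomputable def sptdo (k n : ℕ) : ℕ :=
  Nat.card {π : n.Partition // IsSptDO k π}

/-- As `IsSptDO`, with in addition an even number of parts strictly greater
than the smallest part. -/
def IsSptDOEven (k : ℕ) {n : ℕ} (π : n.Partition) : Prop :=
  ∃ s ∈ π.parts, (∀ x ∈ π.parts, s ≤ x) ∧ Multiset.count s π.parts = k ∧
    (∀ x ∈ π.parts, x ≠ s → Multiset.count x π.parts = 1 ∧ ¬ x % 2 = s % 2) ∧
    Even (Multiset.card (π.parts.filter fun x => s < x))

/-- As `IsSptDO`, with in addition an odd number of parts strictly greater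
than the smallest part. -/
def IsSptDOOdd (k : ℕ) {n : ℕ} (π : n.Partition) : Prop :=
  ∃ s ∈ π.parts, (∀ x ∈ π.parts, s ≤ x) ∧ Multiset.count s π.parts = k ∧
    (∀ x ∈ π.parts, x ≠ s → Multiset.count x π.parts = 1 ∧ ¬ x % 2 = s % 2) ∧
    Odd (Multiset.card (π.parts.filter fun x => s < x))

/-- `B₀(k,n)`. -/
noncomputable def B0 (k n : ℕ) : ℕ :=
  Nat.card {π : n.Partition // IsSptDOEven k π}

/-- `B₁(k,n)`. -/
noncomputable def B1 (k n : ℕ) : ℕ :=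
  Nat.card {π : n.Partition // IsSptDOOdd k π}

/-- `spt k'_{do}(n) = B₀(k,n) - B₁(k,n)`. -/
noncomputable def sptdo' (k n : ℕ) : ℤ :=
  (B0 k n : ℤ) - (B1 k n : ℤ)

/-- `p_d(n)`: number of partitions of `n` into distinct parts. -/
noncomputable def pd (n : ℕ) : ℕ :=
  Nat.card {π : n.Partition // π.parts.Nodup}

/-- `p_{de}(n)`: number of partitions of `n` into distinct even parts. -/
noncomputable def pde (n : ℕ) : ℕ :=
  Nat.card {π : n.Partition // π.parts.Nodup ∧ ∀ x ∈ π.parts, Even x}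

/-- `p_{do}(n)`: number of partitions of `n` into distinct odd parts. -/
noncomputable def pdo (n : ℕ) : ℕ :=
  Nat.card {π : n.Partition // π.parts.Nodup ∧ ∀ x ∈ π.parts, Odd x}

/-- `p'_{do}(n)`: partitions of `n` into an even number of distinct odd parts
minus those into an odd number of distinct odd parts. -/
noncomputable def pdo' (n : ℕ) : ℤ :=
  (Nat.card {π : n.Partition //
      π.parts.Nodup ∧ (∀ x ∈ π.parts, Odd x) ∧ Even (Multiset.card π.parts)} : ℤ) -
  (Nat.card {π : n.Partition //
      π.parts.Nodup ∧ (∀ x ∈ π.parts, Odd x) ∧ Odd (Multiset.card π.parts)} : ℤ)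

/-- Pairs `(s, F)` encoding the partition with smallest part `s` repeated `k` times and set `F` of
larger parts, all of parity opposite to `s`, where the size of `F` satisfies `Q`. -/
def smallestPartPairs (Q : ℕ → Prop) (k n : ℕ) : Set (ℕ × Finset ℕ) :=
  {p | 0 < p.1 ∧ (∀ x ∈ p.2, p.1 < x ∧ ¬ x % 2 = p.1 % 2) ∧ Q p.2.card ∧
    k * p.1 + ∑ x ∈ p.2, x = n}

/-- Pairs `(0, F)` with `F` a set of positive even numbers with sum `n`. -/
def distinctEvenPairs (n : ℕ) : Set (ℕ × Finset ℕ) :=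
  {p | p.1 = 0 ∧ (∀ x ∈ p.2, 0 < x ∧ Even x) ∧ ∑ x ∈ p.2, x = n}

theorem val_sum (F : Finset ℕ) : F.val.sum = ∑ x ∈ F, x := by
  rw [Finset.sum_eq_multiset_sum, Multiset.map_id']

/-- The partition encoded by an element of `smallestPartPairs`. -/
def partitionOfPair {Q : ℕ → Prop} {k n : ℕ} (p : smallestPartPairs Q k n) : n.Partition where
  parts := Multiset.replicate k p.1.1 + p.1.2.val
  parts_pos := by
    obtain ⟨⟨s, F⟩, hs, hF, -, -⟩ := p
    intro x hx
    rcases Multiset.mem_add.1 hx with h | h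
    · rw [Multiset.eq_of_mem_replicate h]
      exact hs
    · exact lt_trans hs (hF x h).1
  parts_sum := by
    obtain ⟨⟨s, F⟩, -, -, -, hn⟩ := p
    rw [Multiset.sum_add, Multiset.sum_replicate, smul_eq_mul, val_sum]
    exact hn

theorem partitionOfPair_injective {Q : ℕ → Prop} {k n : ℕ} (hk : 1 ≤ k) :
    Function.Injective (partitionOfPair : smallestPartPairs Q k n → n.Partition) := by
  rintro ⟨⟨s, F⟩, _, hF, _, _⟩ ⟨⟨s', F'⟩, _, hF', _, _⟩ h
  have h : Multiset.replicate k s + F.val = Multiset.replicate k s' + F'.val :=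
    congrArg Nat.Partition.parts h
  have mem₁ : s ∈ Multiset.replicate k s' + F'.val :=
    h ▸ Multiset.mem_add.2 (.inl (Multiset.mem_replicate.2 ⟨by omega, rfl⟩))
  have mem₂ : s' ∈ Multiset.replicate k s + F.val :=
    h ▸ Multiset.mem_add.2 (.inl (Multiset.mem_replicate.2 ⟨by omega, rfl⟩))
  have hs : s = s' := by
    rcases Multiset.mem_add.1 mem₁ with h₁ | h₁
    · exact Multiset.eq_of_mem_replicate h₁
    rcases Multiset.mem_add.1 mem₂ with h₂ | h₂
    · exact (Multiset.eq_of_mem_replicate h₂).symm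
    exact absurd (hF s' h₂).1 (lt_asymm (hF' s h₁).1)
  subst hs
  have hFF : F = F' := Finset.val_injective (add_left_cancel h)
  subst hFF
  rfl

theorem range_partitionOfPair {Q : ℕ → Prop} {k n : ℕ} (hk : 1 ≤ k) :
    Set.range (partitionOfPair : smallestPartPairs Q k n → n.Partition) =
      {π | ∃ s ∈ π.parts, (∀ x ∈ π.parts, s ≤ x) ∧ Multiset.count s π.parts = k ∧
        (∀ x ∈ π.parts, x ≠ s → Multiset.count x π.parts = 1 ∧ ¬ x % 2 = s % 2) ∧
        Q (Multiset.card (π.parts.filter fun x => s < x))} := by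
  ext π
  constructor
  · rintro ⟨⟨⟨s, F⟩, hs, hF, hQ, hn⟩, rfl⟩
    have hsF : s ∉ F.val := fun h => lt_irrefl _ (hF s h).1
    have mem {x : ℕ} : x ∈ Multiset.replicate k s + F.val ↔ x = s ∨ x ∈ F := by
      simp [Multiset.mem_replicate, show k ≠ 0 by omega]
    refine ⟨s, mem.2 (.inl rfl), fun x hx => ?_, ?_, fun x hx hxs => ?_, ?_⟩
    · rcases mem.1 hx with rfl | h
      exacts [le_rfl, (hF x h).1.le]
    · simp [partitionOfPair, Multiset.count_eq_zero_of_notMem hsF]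
    · have h : x ∈ F := (mem.1 hx).resolve_left hxs
      refine ⟨?_, (hF x h).2⟩
      simp only [partitionOfPair, Multiset.count_add, Multiset.count_replicate]
      rw [if_neg hxs.symm, zero_add, Multiset.count_eq_one_of_mem F.nodup h]
    · have h₁ : (Multiset.replicate k s).filter (fun x => s < x) = 0 :=
        Multiset.filter_eq_nil.2 fun x hx =>
          (Multiset.eq_of_mem_replicate hx) ▸ lt_irrefl _
      have h₂ : F.val.filter (fun x => s < x) = F.val :=
        Multiset.filter_eq_self.2 fun x hx => (hF x hx).1
      simpa [partitionOfPair, Multiset.filter_add, h₁, h₂] using hQ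
  · rintro ⟨s, hs, hmin, hcount, hdis, hQ⟩
    have hnodup : (π.parts.filter fun x => s < x).Nodup := by
      refine Multiset.nodup_iff_count_le_one.2 fun x => ?_
      by_cases hx : x ∈ π.parts.filter fun x => s < x
      · obtain ⟨hx, hlt⟩ := Multiset.mem_filter.1 hx
        exact (Multiset.count_le_of_le x (Multiset.filter_le _ _)).trans (hdis x hx hlt.ne').1.le
      · simp [Multiset.count_eq_zero_of_notMem hx]
    have hparts : Multiset.replicate k s + π.parts.filter (fun x => s < x) = π.parts := by
      rw [← hcount, ← Multiset.filter_eq']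
      conv_rhs => rw [← Multiset.filter_add_not (fun x => x = s) π.parts]
      congr 1
      refine Multiset.filter_congr fun x hx => ?_
      have := hmin x hx
      omega
    refine ⟨⟨(s, ⟨_, hnodup⟩), π.parts_pos hs, fun x hx => ?_, hQ, ?_⟩,
      Nat.Partition.ext hparts⟩
    · obtain ⟨hx, hlt⟩ := Multiset.mem_filter.1 hx
      exact ⟨hlt, (hdis x hx hlt.ne').2⟩
    · have := congrArg Multiset.sum hparts
      rw [π.parts_sum] at this
      rw [Multiset.sum_add, Multiset.sum_replicate, smul_eq_mul] at this
      rwa [← val_sum]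

theorem finite_smallestPartPairs {Q : ℕ → Prop} {k n : ℕ} (hk : 1 ≤ k) :
    (smallestPartPairs Q k n).Finite :=
  Finite.of_injective _ (partitionOfPair_injective (Q := Q) (n := n) hk)

theorem B0_eq_ncard {k n : ℕ} (hk : 1 ≤ k) : B0 k n = (smallestPartPairs Even k n).ncard :=
  (Nat.card_congr ((Equiv.ofInjective _ (partitionOfPair_injective hk)).trans
    (Equiv.setCongr (range_partitionOfPair hk)))).symm

theorem B1_eq_ncard {k n : ℕ} (hk : 1 ≤ k) : B1 k n = (smallestPartPairs Odd k n).ncard :=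
  (Nat.card_congr ((Equiv.ofInjective _ (partitionOfPair_injective hk)).trans
    (Equiv.setCongr (range_partitionOfPair hk)))).symm

/-- Partitions into distinct even parts correspond to `distinctEvenPairs`. -/
def distinctEvenEquiv (n : ℕ) :
    {π : n.Partition // π.parts.Nodup ∧ ∀ x ∈ π.parts, Even x} ≃ distinctEvenPairs n where
  toFun π := ⟨(0, ⟨π.1.parts, π.2.1⟩), rfl, fun x hx => ⟨π.1.parts_pos hx, π.2.2 x hx⟩, by
    rw [← val_sum]
    exact π.1.parts_sum⟩
  invFun p := ⟨⟨p.1.2.val, fun {x} hx => (p.2.2.1 x hx).1, (val_sum _).trans p.2.2.2⟩,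
    p.1.2.nodup, fun x hx => (p.2.2.1 x hx).2⟩
  left_inv _ := rfl
  right_inv p := Subtype.ext (Prod.ext p.2.1.symm rfl)

theorem finite_distinctEvenPairs (n : ℕ) : (distinctEvenPairs n).Finite :=
  Finite.of_equiv _ (distinctEvenEquiv n)

theorem pde_eq_ncard (n : ℕ) : pde n = (distinctEvenPairs n).ncard :=
  Nat.card_congr (distinctEvenEquiv n)

theorem sum_mod_two_of_odd {F : Finset ℕ} (hF : ∀ x ∈ F, x % 2 = 1) :
    (∑ x ∈ F, x) % 2 = F.card % 2 := by
  rw [Finset.sum_nat_mod, Finset.sum_congr rfl hF, Finset.card_eq_sum_ones]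

/-- If the smallest part is even, the parity of the partitioned number is that of the number of
larger parts. -/
theorem smallestPart_odd {Q : ℕ → Prop} {k n : ℕ} {p : ℕ × Finset ℕ}
    (hp : p ∈ smallestPartPairs Q k n) (hn : n % 2 ≠ p.2.card % 2) : p.1 % 2 = 1 := by
  obtain ⟨-, hF, -, hsum⟩ := hp
  by_contra hs
  have h₁ := sum_mod_two_of_odd (F := p.2) fun x hx => by have := (hF x hx).2; omega
  have h₂ : (k * p.1) % 2 = 0 := by rw [Nat.mul_mod, show p.1 % 2 = 0 by omega]; simp
  omega

/-- Lower the smallest part by two; when the number of larger parts is even and the smallest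
part exceeds one, also split off one copy of it, diminished by one, as a larger part. -/
def lowerSmallest (p : ℕ × Finset ℕ) : ℕ × Finset ℕ :=
  (p.1 - 2, if Even p.2.card ∧ 1 < p.1 then insert (p.1 - 1) p.2 else p.2)

/-- Inverse of `lowerSmallest`. -/
def raiseSmallest (p : ℕ × Finset ℕ) : ℕ × Finset ℕ :=
  if p.1 = 0 then (1, p.2) else (p.1 + 2, p.2.erase (p.1 + 1))

theorem ncard_pairs_identity (k t : ℕ) (ht : k ≤ t) :
    (smallestPartPairs Even (k + 1) (2 * t + 1) ∪ smallestPartPairs Odd k (2 * t)).ncard =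
      (smallestPartPairs Odd k (2 * t - 2 * k) ∪ distinctEvenPairs (2 * t - k)).ncard := by
  have mapsTo : ∀ p ∈ smallestPartPairs Even (k + 1) (2 * t + 1) ∪ smallestPartPairs Odd k (2 * t),
      lowerSmallest p ∈ smallestPartPairs Odd k (2 * t - 2 * k) ∪ distinctEvenPairs (2 * t - k) ∧
        raiseSmallest (lowerSmallest p) = p := by
    rintro ⟨s, F⟩ (hp | hp)
    · have hs : s % 2 = 1 := smallestPart_odd hp (by have := Nat.even_iff.1 hp.2.2.1; omega)
      obtain ⟨-, hF, hQ, hsum⟩ := hp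
      dsimp only at hF hQ hsum
      rcases eq_or_ne s 1 with rfl | hs1
      · refine ⟨.inr ⟨rfl, ?_, ?_⟩, by simp [lowerSmallest, raiseSmallest]⟩
        · intro x hx
          have := hF x (by simpa [lowerSmallest] using hx)
          exact ⟨by omega, Nat.even_iff.2 (by omega)⟩
        · simp only [lowerSmallest, lt_irrefl, and_false, if_false]
          omega
      · obtain ⟨r, rfl⟩ : ∃ r, s = r + 2 := ⟨s - 2, by omega⟩
        have hr : r + 1 ∉ F := fun h => by have := (hF _ h).1; omega
        have hlow : lowerSmallest (r + 2, F) = (r, insert (r + 1) F) := by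
          simp [lowerSmallest, hQ]
        rw [hlow]
        refine ⟨.inl ⟨by dsimp only; omega, ?_, ?_, ?_⟩, ?_⟩
        · intro x hx
          dsimp only at hx ⊢
          rcases Finset.mem_insert.1 hx with rfl | h
          · omega
          · have := hF x h
            omega
        · simpa [Finset.card_insert_of_notMem hr] using hQ.add_one
        · dsimp only
          rw [Finset.sum_insert hr]
          have : (k + 1) * (r + 2) = k * r + 2 * k + r + 2 := by ring
          omega
        · simp [raiseSmallest, show r ≠ 0 by omega, hr]
    · have hs : s % 2 = 1 := smallestPart_odd hp (by have := Nat.odd_iff.1 hp.2.2.1; omega)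
      obtain ⟨-, hF, hQ, hsum⟩ := hp
      dsimp only at hF hQ hsum
      have hlow : lowerSmallest (s, F) = (s - 2, F) := by
        simp [lowerSmallest, Nat.not_even_iff_odd.2 hQ]
      rw [hlow]
      rcases eq_or_ne s 1 with rfl | hs1
      · refine ⟨.inr ⟨rfl, fun x hx => ?_, ?_⟩, by simp [raiseSmallest]⟩
        · have := hF x hx
          exact ⟨by omega, Nat.even_iff.2 (by omega)⟩
        · dsimp only
          omega
      · obtain ⟨r, rfl⟩ : ∃ r, s = r + 2 := ⟨s - 2, by omega⟩
        have hr : r + 1 ∉ F := fun h => by have := (hF _ h).1; omega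
        refine ⟨.inl ⟨by dsimp only; omega, fun x hx => ?_, hQ, ?_⟩, ?_⟩
        · have := hF x hx
          dsimp only
          omega
        · dsimp only
          rw [mul_add] at hsum
          rw [Nat.add_sub_cancel]
          omega
        · simp [raiseSmallest, show r ≠ 0 by omega, hr]
  have mapsTo' : ∀ p ∈ smallestPartPairs Odd k (2 * t - 2 * k) ∪ distinctEvenPairs (2 * t - k),
      raiseSmallest p ∈
          smallestPartPairs Even (k + 1) (2 * t + 1) ∪ smallestPartPairs Odd k (2 * t) ∧
        lowerSmallest (raiseSmallest p) = p := by
    rintro ⟨s, F⟩ (hp | hp)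
    · have hs : s % 2 = 1 := smallestPart_odd hp (by have := Nat.odd_iff.1 hp.2.2.1; omega)
      obtain ⟨-, hF, hQ, hsum⟩ := hp
      dsimp only at hF hQ hsum
      have hmul : k * (s + 2) = k * s + 2 * k := by ring
      have hup : raiseSmallest (s, F) = (s + 2, F.erase (s + 1)) := by
        simp [raiseSmallest, show s ≠ 0 by omega]
      have hF' : ∀ x ∈ F.erase (s + 1), s + 2 < x ∧ ¬ x % 2 = (s + 2) % 2 := fun x hx => by
        obtain ⟨hne, hx⟩ := Finset.mem_erase.1 hx
        have := hF x hx
        omega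
      rw [hup]
      by_cases hmem : s + 1 ∈ F
      · have hcard := Finset.card_erase_add_one hmem
        have hE : Even (F.erase (s + 1)).card := by
          rw [← hcard] at hQ
          simpa [Nat.odd_add_one] using hQ
        refine ⟨.inl ⟨by dsimp only; omega, hF', hE, ?_⟩, ?_⟩
        · have h := Finset.add_sum_erase F (fun x => x) hmem
          dsimp only at h ⊢
          rw [add_mul, one_mul]
          omega
        · simp [lowerSmallest, hE, Finset.insert_erase hmem]
      · rw [Finset.erase_eq_of_notMem hmem] at hF' ⊢
        refine ⟨.inr ⟨by dsimp only; omega, hF', hQ, ?_⟩, ?_⟩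
        · dsimp only
          omega
        · simp [lowerSmallest, Nat.not_even_iff_odd.2 hQ]
    · obtain ⟨rfl, hF, hsum⟩ := hp
      dsimp only at hF hsum
      have hF' : ∀ x ∈ F, 1 < x ∧ ¬ x % 2 = 1 % 2 := fun x hx => by
        have := (hF x hx).1
        have := Nat.even_iff.1 (hF x hx).2
        omega
      refine ⟨?_, by simp [raiseSmallest, lowerSmallest]⟩
      rcases Nat.even_or_odd F.card with hQ | hQ
      · exact .inl ⟨one_pos, hF', hQ, by simp only [raiseSmallest, if_true]; omega⟩
      · exact .inr ⟨one_pos, hF', hQ, by simp only [raiseSmallest, if_true]; omega⟩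
  exact Nat.card_congr
    { toFun := fun p => ⟨lowerSmallest p, (mapsTo p p.2).1⟩
      invFun := fun p => ⟨raiseSmallest p, (mapsTo' p p.2).1⟩
      left_inv := fun p => Subtype.ext (mapsTo p p.2).2
      right_inv := fun p => Subtype.ext (mapsTo' p p.2).2 }

theorem statement10 (k t : ℕ) (hk : 1 ≤ k) (ht : k ≤ t) :
    B0 (k + 1) (2 * t + 1) + B1 k (2 * t) = B1 k (2 * t - 2 * k) + pde (2 * t - k) := by
  rw [B0_eq_ncard (by omega), B1_eq_ncard hk, B1_eq_ncard hk, pde_eq_ncard,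
    ← Set.ncard_union_eq ?_ (finite_smallestPartPairs (by omega)) (finite_smallestPartPairs hk),
    ← Set.ncard_union_eq ?_ (finite_smallestPartPairs hk) (finite_distinctEvenPairs _),
    ncard_pairs_identity k t ht]
  · exact Set.disjoint_left.2 fun p hp hp' => hp.1.ne' hp'.1
  · exact Set.disjoint_left.2 fun p hp hp' => Nat.not_even_iff_odd.2 hp'.2.2.1 hp.2.2.1
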